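/- arXiv:math/0605474 — 4 statements merged into one kernel-verified Lean document; each statement's English description precedes it below -/
import Mathlib

section
/- For every integer j and natural number n such that n − j(2j−1) is a nonnegative even integer, the number of partitions of n whose BG-rank equals j is pp((n − j(2j−1))/2). -/
/-- A partition, represented as a weakly decreasing list of positive integers. -/
def IsPartition (l : List ℕ) : Prop :=
  l.Pairwise (· ≥ ·) ∧ ∀ x ∈ l, 0 < x

/-- The BG-rank of a partition `λ₁ ≥ λ₂ ≥ …`:  `Σᵢ (−1)^(i+1) (λᵢ mod 2)`
(with 1-based indexing, i.e. the first part contributes with sign `+1`). -/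
def bgRank (l : List ℕ) : ℤ :=
  ∑ i ∈ Finset.range l.length, (-1 : ℤ) ^ i * ((l.getD i 0 : ℤ) % 2)

/-- `p n`, the number of partitions of `n`. -/
noncomputable def partitionCount (n : ℕ) : ℕ :=
  Nat.card {l : List ℕ // IsPartition l ∧ l.sum = n}

/-- `p_j(n)`, the number of partitions of `n` with BG-rank `j`. -/
noncomputable def pj (j : ℤ) (n : ℕ) : ℕ :=
  Nat.card {l : List ℕ // IsPartition l ∧ l.sum = n ∧ bgRank l = j}

/-- `pp n`, the number of ordered pairs of partitions of total size `n`. -/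
noncomputable def pp (n : ℕ) : ℕ :=
  ∑ k ∈ Finset.range (n + 1), partitionCount k * partitionCount (n - k)

namespace BG

def beta : List ℕ → List ℕ
  | [] => []
  | x :: t => (x + t.length) :: beta t

def unbeta : List ℕ → List ℕ
  | [] => []
  | x :: t => (x - t.length) :: unbeta t

lemma length_beta (l : List ℕ) : (beta l).length = l.length := by
  induction l with
  | nil => rfl
  | cons x t ih => simp [beta, ih]

lemma length_unbeta (l : List ℕ) : (unbeta l).length = l.length := by
  induction l with
  | nil => rfl
  | cons x t ih => simp [unbeta, ih]

lemma beta_lt (t : List ℕ) (x : ℕ) (h : ∀ y ∈ t, y ≤ x) : ∀ z ∈ beta t, z < x + t.length := by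
  induction t with
  | nil => simp [beta]
  | cons y t ih =>
    intro z hz
    simp only [beta, List.mem_cons] at hz
    have := h y (by simp)
    simp only [List.length_cons]
    rcases hz with rfl | hz
    · omega
    · have := ih (fun y hy => h y (by simp [hy])) z hz
      omega

lemma beta_pairwise (t : List ℕ) (h : t.Pairwise (· ≥ ·)) : (beta t).Pairwise (· > ·) := by
  induction t with
  | nil => simp [beta]
  | cons y t ih =>
    rw [List.pairwise_cons] at h
    simp only [beta, List.pairwise_cons]
    exact ⟨fun z hz => beta_lt t y (fun a ha => h.1 a ha) z hz, ih h.2⟩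

lemma len_le (t : List ℕ) (h : t.Pairwise (· > ·)) (y : ℕ) (hy : ∀ z ∈ t, z < y) :
    t.length ≤ y := by
  induction t generalizing y with
  | nil => simp
  | cons z t ih =>
    rw [List.pairwise_cons] at h
    have := ih h.2 z (fun a ha => h.1 a ha)
    have := hy z (by simp)
    simp only [List.length_cons]; omega

lemma unbeta_le (t : List ℕ) (h : t.Pairwise (· > ·)) (y : ℕ) (hy : ∀ z ∈ t, z < y) :
    ∀ w ∈ unbeta t, w + t.length ≤ y := by
  induction t generalizing y with
  | nil => simp [unbeta]
  | cons z t ih =>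
    rw [List.pairwise_cons] at h
    intro w hw
    simp only [unbeta, List.mem_cons] at hw
    have h1 := len_le t h.2 z (fun a ha => h.1 a ha)
    have h2 := hy z (by simp)
    simp only [List.length_cons]
    rcases hw with rfl | hw
    · omega
    · have := ih h.2 z (fun a ha => h.1 a ha) w hw
      omega

lemma unbeta_pairwise (t : List ℕ) (h : t.Pairwise (· > ·)) : (unbeta t).Pairwise (· ≥ ·) := by
  induction t with
  | nil => simp [unbeta]
  | cons y t ih =>
    rw [List.pairwise_cons] at h
    simp only [unbeta, List.pairwise_cons]
    refine ⟨fun z hz => ?_, ih h.2⟩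
    have := unbeta_le t h.2 y (fun a ha => h.1 a ha) z hz
    omega

lemma unbeta_beta (t : List ℕ) : unbeta (beta t) = t := by
  induction t with
  | nil => rfl
  | cons y t ih => simp [beta, unbeta, ih, length_beta]

lemma beta_unbeta (t : List ℕ) (h : t.Pairwise (· > ·)) : beta (unbeta t) = t := by
  induction t with
  | nil => rfl
  | cons y t ih =>
    rw [List.pairwise_cons] at h
    have h1 := len_le t h.2 y (fun a ha => h.1 a ha)
    simp only [beta, unbeta, ih h.2, length_unbeta]
    congr 1; omega

lemma sum_beta (t : List ℕ) :
    2 * ((beta t).sum : ℤ) = 2 * (t.sum : ℤ) + (t.length : ℤ) * ((t.length : ℤ) - 1) := by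
  induction t with
  | nil => simp [beta]
  | cons y t ih =>
    simp only [beta, List.sum_cons, List.length_cons]
    simp only [Nat.cast_add, Nat.cast_one]
    linear_combination ih

lemma bgRank_cons (x : ℕ) (t : List ℕ) : bgRank (x :: t) = (x : ℤ) % 2 - bgRank t := by
  unfold bgRank
  rw [List.length_cons, Finset.sum_range_succ']
  simp [pow_succ, Finset.sum_neg_distrib]
  ring

lemma bgRank_zeros (k : ℕ) : bgRank (List.replicate k 0) = 0 := by
  induction k with
  | zero => simp [bgRank]
  | succ k ih => rw [List.replicate_succ, bgRank_cons, ih]; simp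

lemma bgRank_pad (l : List ℕ) (k : ℕ) : bgRank (l ++ List.replicate k 0) = bgRank l := by
  induction l with
  | nil => rw [List.nil_append, bgRank_zeros]; simp [bgRank]
  | cons x t ih => rw [List.cons_append, bgRank_cons, bgRank_cons, ih]

def D (l : List ℕ) : ℤ := (l.map (fun y => (-1 : ℤ) ^ y)).sum

lemma neg_one_pow_mod (x : ℕ) : (-1 : ℤ) ^ x = 1 - 2 * ((x : ℤ) % 2) := by
  rcases Nat.even_or_odd x with h | h
  · rw [h.neg_one_pow]; obtain ⟨k, rfl⟩ := h; push_cast; omega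
  · rw [h.neg_one_pow]; obtain ⟨k, rfl⟩ := h; push_cast; omega

lemma D_beta (l : List ℕ) :
    (Even l.length → D (beta l) = 2 * bgRank l) ∧
    (¬ Even l.length → D (beta l) = 1 - 2 * bgRank l) := by
  induction l with
  | nil => simp [D, beta, bgRank]
  | cons x t ih =>
    have hD : D (beta (x :: t)) = (-1) ^ x * (-1) ^ t.length + D (beta t) := by
      simp [D, beta, pow_add]
    rw [hD, bgRank_cons, List.length_cons, Nat.even_add_one, neg_one_pow_mod x]
    constructor
    · intro h
      rw [ih.2 h, (Nat.not_even_iff_odd.1 h).neg_one_pow]; ring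
    · intro h
      rw [not_not] at h
      rw [ih.1 h, h.neg_one_pow]; ring

lemma filter_pad (l : List ℕ) (h : ∀ x ∈ l, 0 < x) (k : ℕ) :
    (l ++ List.replicate k 0).filter (fun x => decide (x ≠ 0)) = l := by
  rw [List.filter_append]
  have h1 : l.filter (fun x => decide (x ≠ 0)) = l := by
    rw [List.filter_eq_self]; intro a ha; have := h a ha; simp; omega
  rw [h1]; simp

lemma pad_filter (l : List ℕ) (h : l.Pairwise (· ≥ ·)) :
    l.filter (fun x => decide (x ≠ 0)) ++
      List.replicate (l.length - (l.filter (fun x => decide (x ≠ 0))).length) 0 = l := by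
  induction l with
  | nil => rfl
  | cons x t ih =>
    rw [List.pairwise_cons] at h
    by_cases hx : x = 0
    · subst hx
      have h0 : ∀ a ∈ t, a = 0 := fun a ha => Nat.le_zero.1 (h.1 a ha)
      have : (0 :: t).filter (fun x => decide (x ≠ 0)) = [] := by
        rw [List.filter_eq_nil_iff]; intro a ha
        simp only [List.mem_cons] at ha
        rcases ha with rfl | ha
        · simp
        · simp [h0 a ha]
      rw [this]
      simp only [List.nil_append, List.length_nil, Nat.sub_zero]
      symm
      rw [List.eq_replicate_iff]
      exact ⟨rfl, fun a ha => by
        simp only [List.mem_cons] at ha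
        rcases ha with rfl | ha
        · rfl
        · exact h0 a ha⟩
    · rw [List.filter_cons_of_pos (by simpa using hx)]
      simp only [List.length_cons, List.cons_append, Nat.add_sub_add_right]
      rw [ih h.2]

/-- partitions with at most `K` parts -/
def X (K : ℕ) := {l : List ℕ // IsPartition l ∧ l.length ≤ K}
def W (K : ℕ) := {l : List ℕ // l.Pairwise (· ≥ ·) ∧ l.length = K}
def T (K : ℕ) := {l : List ℕ // l.Pairwise (· > ·) ∧ l.length = K}
def Y (K : ℕ) := {S : Finset ℕ // S.card = K}

def e1 (K : ℕ) : X K ≃ W K where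
  toFun l := ⟨l.1 ++ List.replicate (K - l.1.length) 0, by
    obtain ⟨l, ⟨h1, h2⟩, h3⟩ := l
    refine ⟨?_, by simp; omega⟩
    rw [List.pairwise_append]
    refine ⟨h1, ?_, ?_⟩
    · simp [List.pairwise_replicate]
    · intro a _ b hb
      have := (List.mem_replicate.1 hb).2
      omega⟩
  invFun l := ⟨l.1.filter (fun x => decide (x ≠ 0)), by
    obtain ⟨l, h1, h2⟩ := l
    refine ⟨⟨h1.filter _, ?_⟩, ?_⟩
    · intro x hx
      have := (List.mem_filter.1 hx).2
      simp at this; omega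
    · exact h2 ▸ List.length_filter_le (fun x => decide (x ≠ 0)) l⟩
  left_inv l := Subtype.ext (filter_pad l.1 l.2.1.2 _)
  right_inv l := Subtype.ext (by
    obtain ⟨l, h1, rfl⟩ := l
    exact pad_filter l h1)

def e2 (K : ℕ) : W K ≃ T K where
  toFun l := ⟨beta l.1, beta_pairwise _ l.2.1, by rw [length_beta, l.2.2]⟩
  invFun l := ⟨unbeta l.1, unbeta_pairwise _ l.2.1, by rw [length_unbeta, l.2.2]⟩
  left_inv l := Subtype.ext (unbeta_beta _)
  right_inv l := Subtype.ext (beta_unbeta _ l.2.1)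

lemma nodup_of (l : List ℕ) (h : l.Pairwise (· > ·)) : l.Nodup :=
  h.imp (fun h => ne_of_gt h)

def e3 (K : ℕ) : T K ≃ Y K where
  toFun l := ⟨l.1.toFinset, by rw [List.toFinset_card_of_nodup (nodup_of _ l.2.1), l.2.2]⟩
  invFun S := ⟨S.1.sort (· ≥ ·), by
    refine ⟨?_, by rw [Finset.length_sort, S.2]⟩
    exact (Finset.sortedGT_sort _).pairwise⟩
  left_inv l := Subtype.ext (by
    apply (List.toFinset_sort (r := (· ≥ ·)) (nodup_of _ l.2.1)).2
    exact l.2.1.imp (fun h => le_of_lt h))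
  right_inv S := Subtype.ext (Finset.sort_toFinset _ _)

def e (K : ℕ) : X K ≃ Y K := ((e1 K).trans (e2 K)).trans (e3 K)

lemma e_val (K : ℕ) (l : X K) :
    (e K l).1 = (beta (l.1 ++ List.replicate (K - l.1.length) 0)).toFinset := rfl

lemma e_nodup (K : ℕ) (l : X K) : (beta (l.1 ++ List.replicate (K - l.1.length) 0)).Nodup :=
  nodup_of _ ((e2 K) (e1 K l)).2.1

lemma e_sum (K : ℕ) (l : X K) :
    2 * (∑ y ∈ (e K l).1, (y : ℤ)) = 2 * (l.1.sum : ℤ) + (K : ℤ) * (K - 1) := by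
  have h := sum_beta (l.1 ++ List.replicate (K - l.1.length) 0)
  have hl : (l.1 ++ List.replicate (K - l.1.length) 0).length = K := (e1 K l).2.2
  rw [hl] at h
  rw [e_val, List.sum_toFinset _ (e_nodup K l)]
  have : (l.1 ++ List.replicate (K - l.1.length) 0).sum = l.1.sum := by simp
  rw [this] at h
  rw [← h, Nat.cast_list_sum]

lemma e_D (K : ℕ) (hK : Even K) (l : X K) :
    (∑ y ∈ (e K l).1, (-1 : ℤ) ^ y) = 2 * bgRank l.1 := by
  have h := (D_beta (l.1 ++ List.replicate (K - l.1.length) 0)).1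
  have hl : (l.1 ++ List.replicate (K - l.1.length) 0).length = K := (e1 K l).2.2
  rw [hl, bgRank_pad] at h
  rw [e_val, List.sum_toFinset _ (e_nodup K l)]
  exact h hK

/-- splitting into evens and odds -/
def sp : Finset ℕ × Finset ℕ ≃ Finset ℕ :=
  (Finset.sumEquiv (α := ℕ) (β := ℕ)).symm.toEquiv.trans
    (Equiv.finsetCongr Equiv.natSumNatEquivNat)

lemma sp_sum (p : Finset ℕ × Finset ℕ) (f : ℕ → ℤ) :
    ∑ y ∈ sp p, f y = ∑ a ∈ p.1, f (2 * a) + ∑ b ∈ p.2, f (2 * b + 1) := by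
  have : sp p = (p.1.disjSum p.2).map Equiv.natSumNatEquivNat.toEmbedding := rfl
  rw [this, Finset.sum_map, Finset.sum_disjSum]
  simp

lemma length_le_sum (l : List ℕ) (h : ∀ x ∈ l, 0 < x) : l.length ≤ l.sum := by
  induction l with
  | nil => simp
  | cons x t ih =>
    have := h x (by simp)
    have := ih (fun y hy => h y (by simp [hy]))
    simp only [List.length_cons, List.sum_cons]; omega

instance fin_part (n : ℕ) : Finite {l : List ℕ // IsPartition l ∧ l.sum = n} := by
  let f : {l : List ℕ // IsPartition l ∧ l.sum = n} → Nat.Partition n := fun l =>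
    ⟨(l.1 : Multiset ℕ), fun {i} hi => l.2.1.2 i (by simpa using hi), by simpa using l.2.2⟩
  apply Finite.of_injective f
  intro a b hab
  have h : (a.1 : Multiset ℕ) = b.1 := congrArg Nat.Partition.parts hab
  rw [Multiset.coe_eq_coe] at h
  exact Subtype.ext (h.eq_of_pairwise (fun x y _ _ h1 h2 => le_antisymm h2 h1)
    a.2.1.1 b.2.1.1)

/-- the pair side -/
def PP (m : ℕ) := {p : List ℕ × List ℕ // IsPartition p.1 ∧ IsPartition p.2 ∧
  p.1.sum + p.2.sum = m}

def ePP (m : ℕ) : PP m ≃ Σ k : Fin (m + 1),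
    {l : List ℕ // IsPartition l ∧ l.sum = k.1} × {l : List ℕ // IsPartition l ∧ l.sum = m - k.1} where
  toFun p := ⟨⟨p.1.1.sum, by have := p.2.2.2; omega⟩, ⟨p.1.1, p.2.1, rfl⟩,
    ⟨p.1.2, p.2.2.1, by have := p.2.2.2; simp only; omega⟩⟩
  invFun q := ⟨(q.2.1.1, q.2.2.1), q.2.1.2.1, q.2.2.2.1, by
    have h1 := q.2.1.2.2
    have h2 := q.2.2.2.2
    have := q.1.2
    simp only; omega⟩
  left_inv p := rfl
  right_inv q := by
    obtain ⟨⟨k, hk⟩, ⟨l, hl, hl2⟩, l', hl'⟩ := q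
    simp only at hl2
    subst hl2
    rfl

lemma card_PP (m : ℕ) : Nat.card (PP m) = pp m := by
  rw [Nat.card_congr (ePP m), Nat.card_sigma, pp, ← Fin.sum_univ_eq_sum_range
    (fun k => partitionCount k * partitionCount (m - k))]
  refine Finset.sum_congr rfl fun k _ => ?_
  rw [Nat.card_prod]; rfl

end BG

open BG in
theorem bgrank_count_eq_pp (j : ℤ) (n : ℕ) (m : ℕ)
    (h : (n : ℤ) - j * (2 * j - 1) = 2 * m) :
    pj j n = pp m := by
  obtain ⟨M, hM⟩ : ∃ M : ℕ, M = n + m + j.natAbs := ⟨_, rfl⟩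
  obtain ⟨K, hK⟩ : ∃ K : ℕ, (K : ℤ) = M + j := ⟨(M + j).toNat, by omega⟩
  obtain ⟨L, hL⟩ : ∃ L : ℕ, (L : ℤ) = M - j := ⟨(M - j).toNat, by omega⟩
  rw [← card_PP]
  -- left side
  let A1 : {l : List ℕ // IsPartition l ∧ l.sum = n ∧ bgRank l = j} ≃
      {x : X (2 * M) // x.1.sum = n ∧ bgRank x.1 = j} :=
    { toFun := fun l => ⟨⟨l.1, l.2.1, by
        have h1 := length_le_sum l.1 l.2.1.2
        have h2 := l.2.2.1
        omega⟩, l.2.2⟩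
      invFun := fun x => ⟨x.1.1, x.1.2.1, x.2⟩
      left_inv := fun _ => rfl
      right_inv := fun _ => rfl }
  let A2 : {x : X (2 * M) // x.1.sum = n ∧ bgRank x.1 = j} ≃
      {S : Y (2 * M) // 2 * (∑ y ∈ S.1, (y : ℤ)) = 2 * n + (2 * M) * (2 * M - 1) ∧
        (∑ y ∈ S.1, (-1 : ℤ) ^ y) = 2 * j} :=
    (e (2 * M)).subtypeEquiv (fun x => by
      rw [e_sum, e_D _ (even_two_mul M)]
      rw [Nat.cast_mul, Nat.cast_ofNat]
      constructor
      · rintro ⟨h1, h2⟩; rw [h1, h2]; exact ⟨rfl, rfl⟩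
      · rintro ⟨h1, h2⟩; constructor <;> omega)
  let A3 : {S : Y (2 * M) // 2 * (∑ y ∈ S.1, (y : ℤ)) = 2 * n + (2 * M) * (2 * M - 1) ∧
        (∑ y ∈ S.1, (-1 : ℤ) ^ y) = 2 * j} ≃
      {S : Finset ℕ // S.card = 2 * M ∧
        2 * (∑ y ∈ S, (y : ℤ)) = 2 * n + (2 * M) * (2 * M - 1) ∧
        (∑ y ∈ S, (-1 : ℤ) ^ y) = 2 * j} :=
    { toFun := fun S => ⟨S.1.1, S.1.2, S.2⟩
      invFun := fun S => ⟨⟨S.1, S.2.1⟩, S.2.2⟩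
      left_inv := fun _ => rfl
      right_inv := fun _ => rfl }
  let A4 : {p : Finset ℕ × Finset ℕ // (p.1.card = K ∧ p.2.card = L) ∧
        2 * (∑ y ∈ p.1, (y : ℤ)) + 2 * (∑ y ∈ p.2, (y : ℤ)) =
          2 * m + K * (K - 1) + L * (L - 1)} ≃
      {S : Finset ℕ // S.card = 2 * M ∧
        2 * (∑ y ∈ S, (y : ℤ)) = 2 * n + (2 * M) * (2 * M - 1) ∧
        (∑ y ∈ S, (-1 : ℤ) ^ y) = 2 * j} :=
    sp.subtypeEquiv (fun p => by
      have hc : ((sp p).card : ℤ) = p.1.card + p.2.card := by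
        have := sp_sum p (fun _ => 1)
        simpa using this
      have hd : (∑ y ∈ sp p, (-1 : ℤ) ^ y) = p.1.card - p.2.card := by
        rw [sp_sum]
        simp [pow_add, pow_mul, sub_eq_add_neg]
      have hs : (∑ y ∈ sp p, (y : ℤ)) = 2 * (∑ y ∈ p.1, (y : ℤ)) + 2 * (∑ y ∈ p.2, (y : ℤ))
          + p.2.card := by
        rw [sp_sum]
        push_cast
        rw [Finset.sum_add_distrib, ← Finset.mul_sum, ← Finset.mul_sum]
        simp [add_assoc]
      rw [hd, hs]
      have hcc : (p.1.card = K ∧ p.2.card = L) ↔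
        ((sp p).card = 2 * M ∧ (p.1.card : ℤ) - p.2.card = 2 * j) := by omega
      have hKL : (K : ℤ) * (K - 1) + L * (L - 1) = 2 * M * M + 2 * j * j - 2 * M := by
        rw [hK, hL]; ring
      constructor
      · rintro ⟨h1, h2⟩
        obtain ⟨h3, h4⟩ := hcc.1 h1
        refine ⟨h3, ?_, h4⟩
        rw [h2, h1.2]
        linear_combination 2 * hKL + 2 * hL - 2 * h
      · rintro ⟨h3, h2, h4⟩
        have h1 := hcc.2 ⟨h3, h4⟩
        refine ⟨h1, ?_⟩
        rw [h1.2] at h2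
        have : (2 : ℤ) * (2 * (∑ y ∈ p.1, (y : ℤ)) + 2 * (∑ y ∈ p.2, (y : ℤ))) =
          2 * (2 * m + K * (K - 1) + L * (L - 1)) := by
          linear_combination h2 - 2 * hKL - 2 * hL + 2 * h
        omega)
  let A5 : {p : Finset ℕ × Finset ℕ // (p.1.card = K ∧ p.2.card = L) ∧
        2 * (∑ y ∈ p.1, (y : ℤ)) + 2 * (∑ y ∈ p.2, (y : ℤ)) =
          2 * m + K * (K - 1) + L * (L - 1)} ≃
      {p : Y K × Y L // 2 * (∑ y ∈ p.1.1, (y : ℤ)) + 2 * (∑ y ∈ p.2.1, (y : ℤ)) =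
          2 * m + K * (K - 1) + L * (L - 1)} :=
    { toFun := fun p => ⟨(⟨p.1.1, p.2.1.1⟩, ⟨p.1.2, p.2.1.2⟩), p.2.2⟩
      invFun := fun p => ⟨(p.1.1.1, p.1.2.1), ⟨p.1.1.2, p.1.2.2⟩, p.2⟩
      left_inv := fun _ => rfl
      right_inv := fun _ => rfl }
  let A6 : {p : X K × X L // p.1.1.sum + p.2.1.sum = m} ≃
      {p : Y K × Y L // 2 * (∑ y ∈ p.1.1, (y : ℤ)) + 2 * (∑ y ∈ p.2.1, (y : ℤ)) =
          2 * m + K * (K - 1) + L * (L - 1)} :=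
    (Equiv.prodCongr (e K) (e L)).subtypeEquiv (fun p => by
      have h1 := e_sum K p.1
      have h2 := e_sum L p.2
      simp only [Equiv.prodCongr_apply, Prod.map_fst, Prod.map_snd]
      rw [h1, h2]
      constructor
      · intro h3; rw [← h3]; push_cast; ring
      · intro h3
        have : (2 : ℤ) * (p.1.1.sum + p.2.1.sum) = 2 * m := by linear_combination h3
        omega)
  let A7 : PP m ≃ {p : X K × X L // p.1.1.sum + p.2.1.sum = m} :=
    { toFun := fun p => ⟨(⟨p.1.1, p.2.1, by
          have h1 := length_le_sum p.1.1 p.2.1.2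
          have h2 := p.2.2.2
          omega⟩, ⟨p.1.2, p.2.2.1, by
          have h1 := length_le_sum p.1.2 p.2.2.1.2
          have h2 := p.2.2.2
          omega⟩), p.2.2.2⟩
      invFun := fun p => ⟨(p.1.1.1, p.1.2.1), p.1.1.2.1, p.1.2.2.1, p.2⟩
      left_inv := fun _ => rfl
      right_inv := fun _ => rfl }
  exact Nat.card_congr
    (((((A1.trans A2).trans A3).trans A4.symm).trans A5).trans (A6.symm.trans A7.symm))
end

section
/- For every integer j and natural number n, if n − j(2j−1) is odd or negative, then there is no partition of n with BG-rank equal to j, i.e. p_j(n) = 0. -/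
theorem bgRank_cons (a : ℕ) (l : List ℕ) : bgRank (a :: l) = (a : ℤ) % 2 - bgRank l := by
  unfold bgRank
  rw [List.length_cons, Finset.sum_range_succ']
  simp only [List.getD_cons_succ, List.getD_cons_zero, pow_succ, pow_zero, one_mul]
  rw [sub_eq_add_neg, ← Finset.sum_neg_distrib, add_comm]
  congr 1
  apply Finset.sum_congr rfl
  intros
  ring

theorem bg_key (l : List ℕ) (hl : l.Pairwise (· ≥ ·)) :
    (∀ b : ℕ, (∀ x ∈ l, x ≤ b) → 2 * bgRank l - 1 ≤ b ∧ -2 * bgRank l ≤ b) ∧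
    bgRank l * (2 * bgRank l - 1) ≤ (l.sum : ℤ) ∧ (2 : ℤ) ∣ (l.sum : ℤ) - bgRank l := by
  induction l with
  | nil => simp [bgRank]
  | cons a l ih =>
    rw [List.pairwise_cons] at hl
    obtain ⟨h1, h2, h3⟩ := ih hl.2
    obtain ⟨h4, h5⟩ := h1 a hl.1
    rw [bgRank_cons, List.sum_cons]
    rw [Nat.cast_add]
    generalize bgRank l = r at *
    refine ⟨?_, ?_, by omega⟩
    · intro b hb
      have := hb a (by simp)
      constructor <;> omega
    · rcases Int.emod_two_eq_zero_or_one (a : ℤ) with h | h <;> rw [h]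
      · have : 2 * r ≤ a := by omega
        nlinarith
      · have : 1 - 2 * r ≤ a := by omega
        nlinarith

theorem bgrank_count_eq_zero (j : ℤ) (n : ℕ)
    (h : Odd ((n : ℤ) - j * (2 * j - 1)) ∨ (n : ℤ) - j * (2 * j - 1) < 0) :
    pj j n = 0 := by
  unfold pj
  rw [Nat.card_eq_zero]
  left
  refine ⟨?_⟩
  rintro ⟨l, hl, hs, hr⟩
  obtain ⟨-, h2, h3⟩ := bg_key l hl.1
  rw [hs, hr] at h2 h3
  rcases h with h | h
  · obtain ⟨k, hk⟩ := h
    obtain ⟨m, hm⟩ := h3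
    have : 2 * (m + j - j * j - k) = 1 := by linear_combination hk - hm
    omega
  · linarith
end

section
/- For every natural number n there is a bijection between the set of partitions of n and the set of triples (k, π′, π″), where k is a natural number and π′, π″ are partitions, such that k(k+1)/2 + 2|π′| + 2|π″| = n. Equivalently, p(n) = Σ_{k ≥ 0, n − k(k+1)/2 even and nonnegative} pp((n − k(k+1)/2)/2). -/
namespace TwoCore

lemma equiv_of {α β : Type*} {P : α → Prop} {Q : β → Prop} (f : α → β) (g : β → α)
    (hf : ∀ x, P x → Q (f x)) (hg : ∀ y, Q y → P (g y))
    (h1 : ∀ x, P x → g (f x) = x) (h2 : ∀ y, Q y → f (g y) = y) :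
    Nonempty ({x // P x} ≃ {y // Q y}) :=
  ⟨{ toFun := fun x => ⟨f x.1, hf _ x.2⟩
     invFun := fun y => ⟨g y.1, hg _ y.2⟩
     left_inv := fun x => Subtype.ext (h1 _ x.2)
     right_inv := fun y => Subtype.ext (h2 _ y.2) }⟩

def W (l : List ℕ) : Prop := l.Pairwise (· ≥ ·)
def S (l : List ℕ) : Prop := l.Pairwise (· > ·)

lemma W_perm {l m : List ℕ} (hl : W l) (hm : W m) (h : l.Perm m) : l = m :=
  List.Perm.eq_of_pairwise (fun a b _ _ h1 h2 => le_antisymm h2 h1) hl hm h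

lemma S.W {l : List ℕ} (h : S l) : W l := List.Pairwise.imp (fun h => le_of_lt h) h

/-! padding -/
def pad (a : ℕ) (l : List ℕ) : List ℕ := l ++ List.replicate (a - l.length) 0
def unpad (l : List ℕ) : List ℕ := l.filter (0 < ·)

lemma pad_W {a l} (h : IsPartition l) : W (pad a l) := by
  unfold W pad
  rw [List.pairwise_append]
  refine ⟨h.1, ?_, ?_⟩
  · simp [List.pairwise_replicate]
  · intro x _ y hy
    have := List.eq_of_mem_replicate hy
    omega

lemma pad_length {a l} (h : l.length ≤ a) : (pad a l).length = a := by
  simp [pad]; omega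

lemma pad_sum {a l} : (pad a l).sum = l.sum := by simp [pad]

lemma unpad_part {l} (h : W l) : IsPartition (unpad l) :=
  ⟨List.Pairwise.filter _ h, by simp [unpad]⟩

lemma unpad_sum (l : List ℕ) : (unpad l).sum = l.sum := by
  induction l with
  | nil => rfl
  | cons x t ih =>
    unfold unpad at *
    rcases Nat.eq_zero_or_pos x with h | h
    · subst h; simpa using ih
    · simp [h, ih]

lemma unpad_pad {a l} (h : IsPartition l) : unpad (pad a l) = l := by
  unfold unpad pad
  rw [List.filter_append]
  have h1 : l.filter (0 < ·) = l := List.filter_eq_self.2 (by simpa using h.2)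
  rw [h1]
  simp

lemma pad_unpad {l} (h : W l) : pad l.length (unpad l) = l := by
  apply W_perm (pad_W (unpad_part h)) h
  unfold pad unpad
  have h1 : (l.filter (fun x => !decide (0 < x))) =
      List.replicate (l.length - (l.filter (0 < ·)).length) 0 := by
    rw [List.eq_replicate_iff]
    constructor
    · have := List.length_eq_length_filter_add (l := l) (fun x => decide (0 < x))
      omega
    · simp
  rw [← h1]
  exact List.filter_append_perm _ _

lemma length_le_sum {l} (h : IsPartition l) : l.length ≤ l.sum :=
  List.length_le_sum_of_one_le l h.2

/-! shifting -/
def up : List ℕ → List ℕ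
  | [] => []
  | x :: t => (x + t.length) :: up t
def dn : List ℕ → List ℕ
  | [] => []
  | x :: t => (x - t.length) :: dn t

@[simp] lemma up_length (l) : (up l).length = l.length := by
  induction l <;> simp_all [up]
@[simp] lemma dn_length (l) : (dn l).length = l.length := by
  induction l <;> simp_all [dn]
lemma dn_up (l) : dn (up l) = l := by
  induction l <;> simp_all [up, dn]

lemma up_lt (l : List ℕ) (x : ℕ) (h : ∀ y ∈ l, y ≤ x) : ∀ y ∈ up l, y < x + l.length := by
  induction l with
  | nil => simp [up]
  | cons a t ih =>
    intro y hy
    simp only [up, List.mem_cons] at hy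
    have h1 := h a (by simp)
    simp only [List.length_cons]
    rcases hy with rfl | hy
    · omega
    · have := ih (fun y hy => h y (by simp [hy])) y hy
      omega

lemma up_S {l} (h : W l) : S (up l) := by
  induction l with
  | nil => exact List.Pairwise.nil
  | cons a t ih =>
    unfold W at h
    rw [List.pairwise_cons] at h
    exact List.pairwise_cons.2 ⟨up_lt t a h.1, ih h.2⟩

lemma dn_aux (l : List ℕ) (x : ℕ) (hs : S l) (h : ∀ y ∈ l, y < x) :
    l.length ≤ x ∧ ∀ y ∈ dn l, y + l.length ≤ x := by
  induction l generalizing x with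
  | nil => simp [dn]
  | cons a t ih =>
    unfold S at hs
    rw [List.pairwise_cons] at hs
    have h1 := h a (by simp)
    obtain ⟨h2, h3⟩ := ih a hs.2 hs.1
    simp only [List.length_cons, dn, List.mem_cons]
    refine ⟨by omega, ?_⟩
    rintro y (rfl | hy)
    · omega
    · have := h3 y hy
      omega

lemma dn_W {l} (h : S l) : W (dn l) := by
  induction l with
  | nil => exact List.Pairwise.nil
  | cons a t ih =>
    unfold S at h
    rw [List.pairwise_cons] at h
    refine List.pairwise_cons.2 ⟨?_, ih h.2⟩
    intro y hy
    have := (dn_aux t a h.2 h.1).2 y hy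
    show y ≤ a - t.length
    omega

lemma up_dn {l} (h : S l) : up (dn l) = l := by
  induction l with
  | nil => rfl
  | cons a t ih =>
    unfold S at h
    rw [List.pairwise_cons] at h
    have := (dn_aux t a h.2 h.1).1
    simp only [dn, up, dn_length, ih h.2]
    congr 1
    omega

lemma up_sum (l : List ℕ) : 2 * (up l).sum + l.length = 2 * l.sum + l.length ^ 2 := by
  induction l with
  | nil => rfl
  | cons a t ih =>
    simp only [up, List.sum_cons, List.length_cons]
    nlinarith

/-! splitting -/
def ev (l : List ℕ) : List ℕ := (l.filter (fun x => decide (x % 2 = 0))).map (· / 2)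
def od (l : List ℕ) : List ℕ := (l.filter (fun x => !decide (x % 2 = 0))).map (· / 2)
def pre (A B : List ℕ) : List ℕ := A.map (2 * ·) ++ B.map (2 * · + 1)
def mg (A B : List ℕ) : List ℕ := (pre A B).insertionSort (· ≥ ·)

lemma ev_S {l} (h : S l) : S (ev l) := by
  unfold S ev at *
  rw [List.pairwise_map]
  refine (List.Pairwise.filter _ h).imp_of_mem ?_
  intro a b ha hb hab
  simp at ha hb
  omega

lemma od_S {l} (h : S l) : S (od l) := by
  unfold S od at *
  rw [List.pairwise_map]
  refine (List.Pairwise.filter _ h).imp_of_mem ?_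
  intro a b ha hb hab
  simp at ha hb
  omega

lemma split_length (l) : (ev l).length + (od l).length = l.length := by
  have := List.length_eq_length_filter_add (l := l) (fun x => decide (x % 2 = 0))
  simp only [ev, od, List.length_map]
  omega

lemma pre_split (l) : (pre (ev l) (od l)).Perm l := by
  have h1 : (ev l).map (2 * ·) = l.filter (fun x => decide (x % 2 = 0)) := by
    unfold ev
    rw [List.map_map]
    conv_rhs => rw [← List.map_id (l.filter (fun x => decide (x % 2 = 0)))]
    apply List.map_congr_left
    intro a ha
    simp at ha ⊢
    omega
  have h2 : (od l).map (2 * · + 1) = l.filter (fun x => !decide (x % 2 = 0)) := by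
    unfold od
    rw [List.map_map]
    conv_rhs => rw [← List.map_id (l.filter (fun x => !decide (x % 2 = 0)))]
    apply List.map_congr_left
    intro a ha
    simp at ha ⊢
    omega
  unfold pre
  rw [h1, h2]
  exact List.filter_append_perm _ _

lemma ev_pre (A B) : ev (pre A B) = A := by
  unfold ev pre
  have h1 : (A.map (2 * ·)).filter (fun x => decide (x % 2 = 0)) = A.map (2 * ·) :=
    List.filter_eq_self.2 (by simp)
  have h2 : (B.map (2 * · + 1)).filter (fun x => decide (x % 2 = 0)) = [] :=
    List.filter_eq_nil_iff.2 (by simp)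
  rw [List.filter_append, h1, h2]
  simp [Function.comp_def]

lemma od_pre (A B) : od (pre A B) = B := by
  unfold od pre
  have h1 : (A.map (2 * ·)).filter (fun x => !decide (x % 2 = 0)) = [] :=
    List.filter_eq_nil_iff.2 (by simp)
  have h2 : (B.map (2 * · + 1)).filter (fun x => !decide (x % 2 = 0)) = B.map (2 * · + 1) :=
    List.filter_eq_self.2 (by simp)
  rw [List.filter_append, h1, h2]
  simp only [List.nil_append, List.map_map]
  conv_rhs => rw [← List.map_id B]
  apply List.map_congr_left
  intro a _
  simp; omega

lemma mg_perm (A B) : (mg A B).Perm (pre A B) := List.perm_insertionSort _ _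
lemma mg_W (A B) : W (mg A B) := List.pairwise_insertionSort _ _

lemma S_of {l : List ℕ} (h : W l) (h' : l.Nodup) : S l := by
  refine (List.Pairwise.and h h').imp ?_
  rintro a b ⟨h1, h2⟩
  exact lt_of_le_of_ne h1 (Ne.symm h2)

lemma S.nodup {l : List ℕ} (h : S l) : l.Nodup :=
  List.Pairwise.imp (fun h => (ne_of_lt h).symm) h

lemma pre_nodup {A B} (hA : S A) (hB : S B) : (pre A B).Nodup := by
  unfold pre
  rw [List.nodup_append]
  refine ⟨hA.nodup.map (fun a b h => by simpa using h),
    hB.nodup.map (fun a b h => by simpa using h), ?_⟩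
  intro a ha b hb
  simp at ha hb
  obtain ⟨x, _, rfl⟩ := ha
  obtain ⟨y, _, rfl⟩ := hb
  omega

lemma mg_S {A B} (hA : S A) (hB : S B) : S (mg A B) :=
  S_of (mg_W A B) ((mg_perm A B).nodup_iff.2 (pre_nodup hA hB))

lemma ev_perm {l m : List ℕ} (h : l.Perm m) : (ev l).Perm (ev m) := (h.filter _).map _
lemma od_perm {l m : List ℕ} (h : l.Perm m) : (od l).Perm (od m) := (h.filter _).map _

lemma ev_mg {A B} (hA : S A) (hB : S B) : ev (mg A B) = A := by
  apply W_perm (ev_S (mg_S hA hB)).W hA.W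
  have := ev_perm (mg_perm A B)
  rwa [ev_pre] at this

lemma od_mg {A B} (hA : S A) (hB : S B) : od (mg A B) = B := by
  apply W_perm (od_S (mg_S hA hB)).W hB.W
  have := od_perm (mg_perm A B)
  rwa [od_pre] at this

lemma mg_split {l} (h : S l) : mg (ev l) (od l) = l :=
  W_perm (mg_W _ _) h.W ((mg_perm _ _).trans (pre_split l))

lemma pre_sum (A B) : (pre A B).sum = 2 * A.sum + 2 * B.sum + B.length := by
  have h1 : (A.map (2 * ·)).sum = 2 * A.sum := by
    induction A with
    | nil => rfl
    | cons a t ih => simp only [List.map_cons, List.sum_cons, ih]; ring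
  have h2 : (B.map (2 * · + 1)).sum = 2 * B.sum + B.length := by
    induction B with
    | nil => rfl
    | cons a t ih => simp only [List.map_cons, List.sum_cons, List.length_cons, ih]; ring
  rw [pre, List.sum_append, h1, h2]
  ring

lemma mg_sum (A B) : (mg A B).sum = 2 * A.sum + 2 * B.sum + B.length := by
  rw [(mg_perm A B).sum_eq, pre_sum]

lemma mg_length (A B) : (mg A B).length = A.length + B.length := by
  rw [(mg_perm A B).length_eq]; simp [pre]

lemma split_sum (l : List ℕ) : l.sum = 2 * (ev l).sum + 2 * (od l).sum + (od l).length := by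
  rw [← pre_sum, (pre_split l).sum_eq]

/-! core -/
def aa (M k : ℕ) : ℕ := if k % 2 = 0 then M - k / 2 else M + (k + 1) / 2
def bb (M k : ℕ) : ℕ := if k % 2 = 0 then M + k / 2 else M - (k + 1) / 2
def kk (a b : ℕ) : ℕ := if a ≤ b then b - a else a - b - 1

lemma kk_aa {M k : ℕ} (h : k < M) : kk (aa M k) (bb M k) = k := by
  unfold kk aa bb; split_ifs <;> omega
lemma aa_kk {M a b : ℕ} (h : a + b = 2 * M) : aa M (kk a b) = a := by
  unfold kk aa; split_ifs <;> omega
lemma bb_kk {M a b : ℕ} (h : a + b = 2 * M) : bb M (kk a b) = b := by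
  unfold kk bb; split_ifs <;> omega
lemma ab_add {M k : ℕ} (h : k < M) : aa M k + bb M k = 2 * M := by
  unfold aa bb; split_ifs <;> omega
lemma aa_ge {M k n : ℕ} (h : k + n < M) : n ≤ aa M k := by
  unfold aa; split_ifs <;> omega
lemma bb_ge {M k n : ℕ} (h : k + n < M) : n ≤ bb M k := by
  unfold bb; split_ifs <;> omega

lemma tri (k : ℕ) : 2 * (k * (k + 1) / 2) = k * (k + 1) :=
  Nat.mul_div_cancel' (Nat.even_mul_succ_self k).two_dvd

lemma tri_ge (k : ℕ) : k ≤ k * (k + 1) / 2 := by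
  have := tri k
  rcases Nat.eq_zero_or_pos k with h | h
  · omega
  · nlinarith

/-- quadratic identity -/
lemma quad {M a b : ℕ} (h : a + b = 2 * M) :
    a ^ 2 + b ^ 2 + M = 2 * M ^ 2 + (kk a b * (kk a b + 1) / 2) + a := by
  have ht := tri (kk a b)
  generalize (kk a b * (kk a b + 1) / 2) = t at *
  unfold kk at ht
  split_ifs at ht with h1
  · obtain ⟨c, rfl⟩ := Nat.exists_eq_add_of_le h1
    have : a + c - a = c := by omega
    rw [this] at ht
    nlinarith
  · obtain ⟨c, rfl⟩ := Nat.exists_eq_add_of_lt (not_le.1 h1)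
    have : b + c + 1 - b - 1 = c := by omega
    rw [this] at ht
    nlinarith

/-- forward on padded lists: weight identity -/
lemma weight {M n : ℕ} {A B l : List ℕ} (hab : A.length + B.length = 2 * M)
    (hl : up l = mg (up A) (up B)) :
    l.sum = kk A.length B.length * (kk A.length B.length + 1) / 2 + 2 * A.sum + 2 * B.sum := by
  have h1 := up_sum A
  have h2 := up_sum B
  have h3 := up_sum l
  have h4 := mg_sum (up A) (up B)
  have h5 := mg_length (up A) (up B)
  rw [← hl] at h4 h5
  simp only [up_length] at h4 h5
  have h6 := quad hab
  rw [h5, hab] at h3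
  nlinarith

theorem main_equiv (n : ℕ) : Nonempty
      ({l : List ℕ // IsPartition l ∧ l.sum = n} ≃
        {t : ℕ × List ℕ × List ℕ //
          IsPartition t.2.1 ∧ IsPartition t.2.2 ∧
            t.1 * (t.1 + 1) / 2 + 2 * t.2.1.sum + 2 * t.2.2.sum = n}) := by
  obtain ⟨M, hM⟩ : ∃ M, M = 2 * n + 1 := ⟨_, rfl⟩
  let A : List ℕ → List ℕ := fun l => dn (ev (up (pad (2 * M) l)))
  let B : List ℕ → List ℕ := fun l => dn (od (up (pad (2 * M) l)))
  let C : ℕ × List ℕ × List ℕ → List ℕ := fun t =>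
    mg (up (pad (aa M t.1) t.2.1)) (up (pad (bb M t.1) t.2.2))
  have key : ∀ l, IsPartition l → l.sum = n →
      W (A l) ∧ W (B l) ∧ (A l).length + (B l).length = 2 * M ∧
      mg (up (A l)) (up (B l)) = up (pad (2 * M) l) := by
    intro l hl hs
    have h1 : S (up (pad (2 * M) l)) := up_S (pad_W hl)
    have hlen := length_le_sum hl
    refine ⟨dn_W (ev_S h1), dn_W (od_S h1), ?_, ?_⟩
    · simp only [A, B, dn_length, split_length, up_length]
      exact pad_length (by omega)
    · simp only [A, B]
      rw [up_dn (ev_S h1), up_dn (od_S h1), mg_split h1]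
  have key2 : ∀ t : ℕ × List ℕ × List ℕ, (IsPartition t.2.1 ∧ IsPartition t.2.2 ∧
            t.1 * (t.1 + 1) / 2 + 2 * t.2.1.sum + 2 * t.2.2.sum = n) →
      t.1 < M ∧ (pad (aa M t.1) t.2.1).length = aa M t.1 ∧
      (pad (bb M t.1) t.2.2).length = bb M t.1 ∧ S (C t) ∧
      (C t).length = 2 * M := by
    rintro ⟨k, P, Q⟩ ⟨hP, hQ, hs⟩
    simp only at hP hQ hs ⊢
    have h1 := tri_ge k
    have h2 := length_le_sum hP
    have h3 := length_le_sum hQ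
    have h4 : n ≤ aa M k := aa_ge (by omega)
    have h5 : n ≤ bb M k := bb_ge (by omega)
    have h6 : (pad (aa M k) P).length = aa M k := pad_length (by omega)
    have h7 : (pad (bb M k) Q).length = bb M k := pad_length (by omega)
    refine ⟨by omega, h6, h7, mg_S (up_S (pad_W hP)) (up_S (pad_W hQ)), ?_⟩
    simp only [C, mg_length, up_length, h6, h7]
    exact ab_add (by omega)
  apply equiv_of (fun l => (kk (A l).length (B l).length, unpad (A l), unpad (B l)))
    (fun t => unpad (dn (C t)))
  · rintro l ⟨hl, hs⟩
    obtain ⟨h1, h2, h3, h4⟩ := key l hl hs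
    refine ⟨unpad_part h1, unpad_part h2, ?_⟩
    simp only [unpad_sum]
    rw [← weight (n := n) h3 h4.symm, pad_sum, hs]
  · intro t ht
    obtain ⟨h1, h2, h3, h4, h5⟩ := key2 t ht
    refine ⟨unpad_part (dn_W h4), ?_⟩
    rw [unpad_sum, weight (n := n) (M := M) (A := pad (aa M t.1) t.2.1)
      (B := pad (bb M t.1) t.2.2) (by rw [h2, h3, ab_add h1]) (up_dn h4), h2, h3, kk_aa h1,
      pad_sum, pad_sum]
    exact ht.2.2
  · rintro l ⟨hl, hs⟩
    obtain ⟨h1, h2, h3, h4⟩ := key l hl hs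
    simp only [C]
    rw [aa_kk h3, bb_kk h3, pad_unpad h1, pad_unpad h2, h4, dn_up, unpad_pad hl]
  · intro t ht
    obtain ⟨h1, h2, h3, h4, h5⟩ := key2 t ht
    have h6 : up (pad (2 * M) (unpad (dn (C t)))) = C t := by
      have : pad (dn (C t)).length (unpad (dn (C t))) = dn (C t) := pad_unpad (dn_W h4)
      rw [dn_length, h5] at this
      rw [this, up_dn h4]
    have hu1 := up_S (pad_W (a := aa M t.1) ht.1)
    have hu2 := up_S (pad_W (a := bb M t.1) ht.2.1)
    have hA : A (unpad (dn (C t))) = pad (aa M t.1) t.2.1 := by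
      simp only [A]
      rw [h6]
      simp only [C]
      rw [ev_mg hu1 hu2, dn_up]
    have hB : B (unpad (dn (C t))) = pad (bb M t.1) t.2.2 := by
      simp only [B]
      rw [h6]
      simp only [C]
      rw [od_mg hu1 hu2, dn_up]
    simp only [hA, hB, h2, h3, kk_aa h1, unpad_pad ht.1, unpad_pad ht.2.1]

/-! counting -/
lemma fin_part (n : ℕ) : {l : List ℕ | IsPartition l ∧ l.sum = n}.Finite := by
  let f : {l : List ℕ // IsPartition l ∧ l.sum = n} → Nat.Partition n := fun l =>
    { parts := (l.1 : Multiset ℕ)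
      parts_pos := fun {i} hi => l.2.1.2 i (by simpa using hi)
      parts_sum := by simpa using l.2.2 }
  have hf : Function.Injective f := by
    intro a b h
    have h' : (a.1 : Multiset ℕ) = b.1 := congrArg Nat.Partition.parts h
    exact Subtype.ext (W_perm a.2.1.1 b.2.1.1 (Multiset.coe_eq_coe.1 h'))
  exact Set.finite_coe_iff.1 (Finite.of_injective f hf)

noncomputable def Pf (n : ℕ) : Finset (List ℕ) := (fin_part n).toFinset

lemma mem_Pf {n l} : l ∈ Pf n ↔ IsPartition l ∧ l.sum = n := by simp [Pf]

lemma card_Pf (n : ℕ) : partitionCount n = (Pf n).card := by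
  unfold partitionCount
  exact Nat.subtype_card (Pf n) (fun l => mem_Pf)

noncomputable def pairs (m : ℕ) : Finset (List ℕ × List ℕ) :=
  (Finset.range (m + 1)).biUnion (fun j => Pf j ×ˢ Pf (m - j))

lemma mem_pairs {m : ℕ} {x : List ℕ × List ℕ} : x ∈ pairs m ↔
    IsPartition x.1 ∧ IsPartition x.2 ∧ x.1.sum + x.2.sum = m := by
  simp only [pairs, Finset.mem_biUnion, Finset.mem_range, Finset.mem_product, mem_Pf]
  constructor
  · rintro ⟨j, h, ⟨h1, h2⟩, h3, h4⟩
    exact ⟨h1, h3, by omega⟩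
  · rintro ⟨h1, h2, h3⟩
    exact ⟨x.1.sum, by omega, ⟨h1, rfl⟩, h2, by omega⟩

lemma card_pairs (m : ℕ) : pp m = (pairs m).card := by
  unfold pp pairs
  rw [Finset.card_biUnion]
  · simp [card_Pf]
  · intro i _ j _ hij
    rw [Function.onFun, Finset.disjoint_left]
    intro x hx hy
    simp only [Finset.mem_product, mem_Pf] at hx hy
    exact hij (hx.1.2.symm.trans hy.1.2)

noncomputable def T (n : ℕ) : Finset (ℕ × List ℕ × List ℕ) :=
  (Finset.range (n + 1)).biUnion fun k => (Finset.range (n + 1)).biUnion fun m =>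
    if k * (k + 1) / 2 + 2 * m = n then {k} ×ˢ pairs m else ∅

lemma mem_inner {n k m : ℕ} {t : ℕ × List ℕ × List ℕ} :
    (t ∈ if k * (k + 1) / 2 + 2 * m = n then ({k} : Finset ℕ) ×ˢ pairs m else ∅) ↔
    (k * (k + 1) / 2 + 2 * m = n ∧ t.1 = k ∧ IsPartition t.2.1 ∧ IsPartition t.2.2 ∧
      t.2.1.sum + t.2.2.sum = m) := by
  split_ifs with h
  · rw [Finset.mem_product, Finset.mem_singleton, mem_pairs]
    simp [h]
  · simp [h]

lemma mem_T {n : ℕ} {t : ℕ × List ℕ × List ℕ} : t ∈ T n ↔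
    (IsPartition t.2.1 ∧ IsPartition t.2.2 ∧
            t.1 * (t.1 + 1) / 2 + 2 * t.2.1.sum + 2 * t.2.2.sum = n) := by
  simp only [T, Finset.mem_biUnion, Finset.mem_range, mem_inner]
  constructor
  · rintro ⟨k, _, m, _, h, rfl, h1, h2, h3⟩
    exact ⟨h1, h2, by omega⟩
  · rintro ⟨h1, h2, h3⟩
    have := tri_ge t.1
    exact ⟨t.1, by omega, t.2.1.sum + t.2.2.sum, by omega, by omega, rfl, h1, h2, rfl⟩

lemma card_T (n : ℕ) : (T n).card = ∑ k ∈ Finset.range (n + 1), ∑ m ∈ Finset.range (n + 1),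
        if k * (k + 1) / 2 + 2 * m = n then pp m else 0 := by
  unfold T
  rw [Finset.card_biUnion]
  · apply Finset.sum_congr rfl
    intro k _
    rw [Finset.card_biUnion]
    · apply Finset.sum_congr rfl
      intro m _
      split_ifs
      · simp [card_pairs]
      · simp
    · intro i _ j _ hij
      rw [Function.onFun, Finset.disjoint_left]
      intro x hx hy
      rw [mem_inner] at hx hy
      omega
  · intro i _ j _ hij
    rw [Function.onFun, Finset.disjoint_left]
    intro x hx hy
    simp only [Finset.mem_biUnion, mem_inner] at hx hy
    obtain ⟨_, _, _, h1, _⟩ := hx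
    obtain ⟨_, _, _, h2, _⟩ := hy
    exact hij (h1.symm.trans h2)

end TwoCore

theorem two_core_decomposition (n : ℕ) :
    Nonempty
      ({l : List ℕ // IsPartition l ∧ l.sum = n} ≃
        {t : ℕ × List ℕ × List ℕ //
          IsPartition t.2.1 ∧ IsPartition t.2.2 ∧
            t.1 * (t.1 + 1) / 2 + 2 * t.2.1.sum + 2 * t.2.2.sum = n}) ∧
    partitionCount n =
      ∑ k ∈ Finset.range (n + 1), ∑ m ∈ Finset.range (n + 1),
        if k * (k + 1) / 2 + 2 * m = n then pp m else 0 := by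
  refine ⟨TwoCore.main_equiv n, ?_⟩
  obtain ⟨e⟩ := TwoCore.main_equiv n
  rw [← TwoCore.card_T, partitionCount, Nat.card_congr e]
  exact Nat.subtype_card (TwoCore.T n) (fun t => TwoCore.mem_T)
end

section
/- For every natural number n and every integer j with j ≡ 1, 2, or 4 (mod 5), the number p_j(5n+2) of partitions of 5n+2 with BG-rank j is divisible by 5. -/
section Jacobi
variable {A : Type*} [CommRing A]

/-- finite q-Pochhammer product -/
def qP (q : A) (n : ℕ) : A := ∏ i ∈ Finset.range n, (1 - q ^ (i + 1))

theorem qP_succ (q : A) (n : ℕ) : qP q (n + 1) = qP q n * (1 - q ^ (n + 1)) := by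
  simp [qP, Finset.prod_range_succ]

theorem qP_zero (q : A) : qP q 0 = 1 := by simp [qP]

/-- Gaussian binomial -/
def qG (q : A) : ℕ → ℕ → A
  | _, 0 => 1
  | 0, _ + 1 => 0
  | n + 1, m + 1 => q ^ (m + 1) * qG q n (m + 1) + qG q n m

theorem qG_zero_right (q : A) (n : ℕ) : qG q n 0 = 1 := by cases n <;> simp [qG]

theorem qG_of_lt (q : A) (n m : ℕ) (h : n < m) : qG q n m = 0 := by
  induction n generalizing m with
  | zero => cases m with
    | zero => omega
    | succ m => simp [qG]
  | succ n ih => cases m with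
    | zero => omega
    | succ m => simp [qG, ih (m + 1) (by omega), ih m (by omega)]

theorem qG_self (q : A) (n : ℕ) : qG q n n = 1 := by
  induction n with
  | zero => simp [qG]
  | succ n ih => simp [qG, ih, qG_of_lt q n (n + 1) (by omega)]

theorem qG_mul (q : A) (s : ℕ) : ∀ a b : ℕ, a + b = s →
    qG q (a + b) a * qP q a * qP q b = qP q (a + b) := by
  induction s with
  | zero =>
    intro a b h
    obtain rfl : a = 0 := by omega
    obtain rfl : b = 0 := by omega
    simp [qG, qP_zero]
  | succ s ih =>
    intro a b h
    rcases a with _ | a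
    · simp [qG_zero_right, qP_zero]
    rcases b with _ | b
    · simp [qG_self, qP_zero]
    have h1 := ih (a + 1) b (by omega)
    have h2 := ih a (b + 1) (by omega)
    have e1 : a + 1 + (b + 1) = (a + b + 1) + 1 := by ring
    have e2 : a + 1 + b = a + b + 1 := by ring
    have e3 : a + (b + 1) = a + b + 1 := by ring
    rw [e1]
    rw [e2] at h1
    rw [e3] at h2
    rw [qG, qP_succ q (a + b + 1), qP_succ q b, qP_succ q a]
    rw [qP_succ q a] at h1
    rw [qP_succ q b] at h2
    linear_combination (q ^ (a + 1) * (1 - q ^ (b + 1))) * h1 + (1 - q ^ (a + 1)) * h2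

open Polynomial in
theorem qbinom_thm (q : A) (n : ℕ) : ∀ z : A,
    ∏ i ∈ Finset.range n, ((X : A[X]) + C (z * q ^ i)) =
      ∑ m ∈ Finset.range (n + 1), C (q ^ (m.choose 2) * qG q n m * z ^ m) * X ^ (n - m) := by
  induction n with
  | zero => intro z; simp [qG]
  | succ n ih =>
    intro z
    rw [Finset.prod_range_succ']
    have : ∀ i, z * q ^ (i + 1) = (z * q) * q ^ i := fun i => by ring
    simp only [this]
    rw [ih, Finset.sum_range_succ' _ (n + 1)]
    simp only [qG]
    have key : ∀ m ∈ Finset.range (n + 1),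
        C (q ^ ((m + 1).choose 2) * (q ^ (m + 1) * qG q n (m + 1) + qG q n m) * z ^ (m + 1)) * X ^ (n + 1 - (m + 1))
        = C (q ^ ((m + 1).choose 2) * qG q n (m + 1) * (z * q) ^ (m + 1)) * X ^ (n - (m + 1)) * X
          + C (q ^ (m.choose 2) * qG q n m * (z * q) ^ m) * X ^ (n - m) * C z := by
      intro m hm
      have e : (m + 1).choose 2 = m.choose 2 + m := by
        rw [Nat.choose_succ_succ' m 1]; simp; ring
      rcases Nat.lt_or_ge m n with h | h
      · obtain ⟨k, rfl⟩ : ∃ k, n = m + 1 + k := ⟨n - (m + 1), by omega⟩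
        have e1 : m + 1 + k + 1 - (m + 1) = k + 1 := by omega
        have e2 : m + 1 + k - (m + 1) = k := by omega
        have e3 : m + 1 + k - m = k + 1 := by omega
        rw [e1, e2, e3, e]
        simp only [map_add, map_mul, map_pow]
        ring
      · obtain rfl : n = m := by
          have := Finset.mem_range.mp hm
          omega
        rw [qG_of_lt q n (n + 1) (by omega), e]
        simp only [map_add, map_mul, map_pow, map_zero]
        simp
        ring
    rw [Finset.sum_congr rfl key, Finset.sum_add_distrib, ← Finset.sum_mul, ← Finset.sum_mul]
    have s := Finset.sum_range_succ' (fun m => C (q ^ (m.choose 2) * qG q n m * (z * q) ^ m) * X ^ (n - m)) (n + 1)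
    rw [Finset.sum_range_succ (fun m => C (q ^ (m.choose 2) * qG q n m * (z * q) ^ m) * X ^ (n - m)) (n + 1)] at s
    rw [qG_of_lt q n (n + 1) (by omega)] at s
    simp only [qG_zero_right, mul_zero, zero_mul, map_zero, add_zero] at s
    have s' := congrArg (· * (X : A[X])) s
    simp only [add_mul] at s'
    simp at s'
    simp
    linear_combination s' 

/-- exponent -/
def tt (N m : ℕ) : ℕ := (((N : ℤ) - m) * ((N : ℤ) - m + 1) / 2).toNat

theorem tt_spec (N m : ℕ) : 2 * (tt N m : ℤ) = ((N : ℤ) - m) * ((N : ℤ) - m + 1) := by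
  unfold tt
  have h1 : 2 ∣ ((N : ℤ) - m) * ((N : ℤ) - m + 1) := (Int.even_mul_succ_self _).two_dvd
  have h2 : 0 ≤ ((N : ℤ) - m) * ((N : ℤ) - m + 1) := by
    rcases le_or_gt 0 ((N : ℤ) - m) with h | h
    · positivity
    · nlinarith
  rw [Int.toNat_of_nonneg (by omega)]
  omega

theorem two_choose (m : ℕ) : 2 * (m.choose 2 : ℤ) = m * (m - 1) := by
  induction m with
  | zero => simp
  | succ m ih =>
    have e : (m + 1).choose 2 = m.choose 2 + m := by
      rw [Nat.choose_succ_succ' m 1]; simp; ring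
    rw [e]; push_cast; linarith

theorem tt_exp (N m : ℕ) (h : m ≤ 2 * N + 1) :
    m.choose 2 + N * (2 * N + 1 - m) = tt N m + (N.choose 2 + N * N + N) := by
  have h1 := tt_spec N m
  have h2 := two_choose m
  have h3 := two_choose N
  zify [h]
  linarith

open Polynomial in
theorem jacobi_fin [IsDomain A] (q : A) (hq : q ≠ 0) (N : ℕ) :
    2 * (-1) ^ N * qP q N ^ 2 =
      ∑ m ∈ Finset.range (2 * N + 2), (-1) ^ m * (2 * (N : A) + 1 - 2 * m) * q ^ tt N m * qG q (2 * N + 1) m := by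
  have hb := qbinom_thm q (2 * N + 1) (-1)
  have e0 := congrArg (eval (q ^ N)) hb
  have e1 := congrArg (fun p => eval (q ^ N) (derivative p)) hb
  have hsplit : ∏ i ∈ Finset.range (2 * N + 1), ((X : A[X]) + C (-1 * q ^ i)) =
      (∏ i ∈ Finset.range N, ((X : A[X]) + C (-1 * q ^ i))) *
      (∏ i ∈ Finset.range N, ((X : A[X]) + C (-1 * q ^ (N + 1 + i)))) * (X - C (q ^ N)) := by
    rw [show 2 * N + 1 = N + 1 + N by ring, Finset.prod_range_add, Finset.prod_range_succ]
    simp only [neg_mul, one_mul, map_neg]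
    ring
  have hA : ∏ i ∈ Finset.range N, (q ^ N - q ^ i) = (-1) ^ N * q ^ (N.choose 2) * qP q N := by
    have : ∀ i ∈ Finset.range N, (q ^ N - q ^ i) = (-1) * q ^ i * (1 - q ^ (N - 1 - i + 1)) := by
      intro i hi
      have := Finset.mem_range.mp hi
      rw [show N - 1 - i + 1 = N - i by omega]
      have : q ^ N = q ^ i * q ^ (N - i) := by rw [← pow_add]; congr 1; omega
      rw [this]; ring
    rw [Finset.prod_congr rfl this, Finset.prod_mul_distrib, Finset.prod_mul_distrib,
      Finset.prod_range_reflect (fun i => 1 - q ^ (i + 1)) N, Finset.prod_pow_eq_pow_sum]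
    simp [qP, Finset.sum_range_id, Nat.choose_two_right]
  have hB : ∏ i ∈ Finset.range N, (q ^ N - q ^ (N + 1 + i)) = q ^ (N * N) * qP q N := by
    have : ∀ i ∈ Finset.range N, (q ^ N - q ^ (N + 1 + i)) = q ^ N * (1 - q ^ (i + 1)) := by
      intro i hi
      ring
    rw [Finset.prod_congr rfl this, Finset.prod_mul_distrib]
    simp [qP, pow_mul]
  rw [hsplit] at e0
  simp only [hsplit] at e1
  rw [derivative_mul] at e1
  simp only [derivative_sum, derivative_C_mul, derivative_X_pow, derivative_sub, derivative_X, derivative_C] at e1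
  simp [eval_finsetSum, eval_prod] at e0
  simp [eval_finsetSum, eval_prod, ← sub_eq_add_neg] at e1
  rw [hA, hB] at e1
  have hq' : q ^ (N.choose 2 + N * N + N) ≠ 0 := pow_ne_zero _ hq
  apply mul_left_cancel₀ hq'
  rw [Finset.mul_sum]
  have key : ∀ m ∈ Finset.range (2 * N + 2),
      q ^ (N.choose 2 + N * N + N) * ((-1) ^ m * (2 * (N : A) + 1 - 2 * m) * q ^ tt N m * qG q (2 * N + 1) m) =
      2 * q ^ N * (q ^ (m.choose 2) * qG q (2 * N + 1) m * (-1) ^ m * (((2 * N + 1 - m : ℕ) : A) * (q ^ N) ^ (2 * N + 1 - m - 1)))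
       - (2 * N + 1) * (q ^ (m.choose 2) * qG q (2 * N + 1) m * (-1) ^ m * (q ^ N) ^ (2 * N + 1 - m)) := by
    intro m hm
    have hm' : m ≤ 2 * N + 1 := by have := Finset.mem_range.mp hm; omega
    have hx : q ^ (N.choose 2 + N * N + N) * q ^ tt N m = q ^ (m.choose 2) * (q ^ N) ^ (2 * N + 1 - m) := by
      rw [← pow_mul, ← pow_add, ← pow_add, tt_exp N m hm']; congr 1; ring
    have hy : q ^ N * (((2 * N + 1 - m : ℕ) : A) * (q ^ N) ^ (2 * N + 1 - m - 1)) = ((2 * N + 1 - m : ℕ) : A) * (q ^ N) ^ (2 * N + 1 - m) := by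
      rcases Nat.eq_zero_or_pos (2 * N + 1 - m) with h | h
      · rw [h]; simp
      · obtain ⟨k, hk⟩ : ∃ k, 2 * N + 1 - m = k + 1 := ⟨2 * N + 1 - m - 1, by omega⟩
        rw [hk]; simp; ring
    have hz : ((2 * N + 1 - m : ℕ) : A) = 2 * N + 1 - m := by
      rw [Nat.cast_sub hm']; push_cast; ring
    rw [hz] at hy ⊢
    linear_combination ((-1) ^ m * (2 * (N : A) + 1 - 2 * m) * qG q (2 * N + 1) m) * hx - 2 * (q ^ (m.choose 2) * qG q (2 * N + 1) m * (-1) ^ m) * hy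
  rw [Finset.sum_congr rfl key, Finset.sum_sub_distrib, ← Finset.mul_sum, ← Finset.mul_sum]
  rw [← e1, ← e0]
  ring

end Jacobi

section BG

theorem bgRank_nil : bgRank [] = 0 := by simp [bgRank]

/-- partitions with parts at most N -/
def VV (N : ℕ) (j : ℤ) (s : ℕ) : Set (List ℕ) :=
  {l | IsPartition l ∧ l.sum = s ∧ bgRank l = j ∧ ∀ x ∈ l, x ≤ N}

theorem length_le_sum (l : List ℕ) (h : ∀ x ∈ l, 0 < x) : l.length ≤ l.sum := by
  induction l with
  | nil => simp
  | cons a l ih =>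
    have h1 := h a (by simp)
    have h2 := ih (fun x hx => h x (by simp [hx]))
    simp; omega

theorem VV_finite (N : ℕ) (j : ℤ) (s : ℕ) : (VV N j s).Finite := by
  apply ((List.finite_length_le (Fin (N + 1)) s).image (List.map Fin.val)).subset
  rintro l ⟨⟨h1, h2⟩, h3, h4, h5⟩
  refine ⟨l.map (fun x => Fin.ofNat (N + 1) x), ?_, ?_⟩
  · have := length_le_sum l h2
    simp; omega
  · rw [List.map_map]
    conv_rhs => rw [← List.map_id l]
    apply List.map_congr_left
    intro x hx
    have := h5 x hx
    simp [Fin.ofNat]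
    omega

theorem VV_succ (N : ℕ) (j : ℤ) (s : ℕ) :
    (VV (N + 1) j s).ncard = (VV N j s).ncard +
      if N + 1 ≤ s then (VV (N + 1) (((N + 1 : ℕ) : ℤ) % 2 - j) (s - (N + 1))).ncard else 0 := by
  have hsplit : VV (N + 1) j s = VV N j s ∪
      (if N + 1 ≤ s then List.cons (N + 1) '' VV (N + 1) (((N + 1 : ℕ) : ℤ) % 2 - j) (s - (N + 1)) else ∅) := by
    ext l
    constructor
    · rintro ⟨⟨h1, h2⟩, h3, h4, h5⟩
      by_cases h : ∀ x ∈ l, x ≤ N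
      · left; exact ⟨⟨h1, h2⟩, h3, h4, h⟩
      · right
        rcases l with _ | ⟨a, l⟩
        · simp at h
        have ha : a = N + 1 := by
          push Not at h
          obtain ⟨x, hx, hxN⟩ := h
          have hx1 := h5 x hx
          have ha1 := h5 a (by simp)
          rcases List.mem_cons.mp hx with rfl | hx
          · omega
          · have := (List.pairwise_cons.mp h1).1 x hx
            omega
        subst ha
        rw [List.sum_cons] at h3
        rw [if_pos (by omega)]
        refine ⟨l, ⟨⟨(List.pairwise_cons.mp h1).2, fun x hx => h2 x (by simp [hx])⟩, by omega, ?_, fun x hx => h5 x (by simp [hx])⟩, rfl⟩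
        rw [bgRank_cons] at h4
        omega
    · rintro (⟨h1, h3, h4, h5⟩ | h)
      · exact ⟨h1, h3, h4, fun x hx => (h5 x hx).trans (by omega)⟩
      · split_ifs at h with hs
        · obtain ⟨l, ⟨⟨h1, h2⟩, h3, h4, h5⟩, rfl⟩ := h
          refine ⟨⟨List.pairwise_cons.mpr ⟨fun x hx => h5 x hx, h1⟩, ?_⟩, ?_, ?_, ?_⟩
          · intro x hx
            rcases List.mem_cons.mp hx with rfl | hx
            · omega
            · exact h2 x hx
          · rw [List.sum_cons]; omega
          · rw [bgRank_cons, h4]; omega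
          · intro x hx
            rcases List.mem_cons.mp hx with rfl | hx
            · omega
            · exact h5 x hx
        · simp at h
  split_ifs at hsplit ⊢ with hs
  · rw [hsplit, Set.ncard_union_eq _ (VV_finite _ _ _) ((VV_finite _ _ _).image _),
      Set.ncard_image_of_injective _ (List.cons_injective)]
    rw [Set.disjoint_left]
    rintro l ⟨_, _, _, h5⟩ ⟨l', _, rfl⟩
    have := h5 (N + 1) (by simp)
    omega
  · rw [hsplit]; simp

theorem pj_eq_VV (j : ℤ) (n N : ℕ) (h : n ≤ N) : pj j n = (VV N j n).ncard := by
  unfold pj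
  rw [← Nat.card_coe_set_eq]
  congr 1
  have : {l : List ℕ | IsPartition l ∧ l.sum = n ∧ bgRank l = j} = VV N j n := by
    ext l
    constructor
    · rintro ⟨h1, h2, h3⟩
      exact ⟨h1, h2, h3, fun x hx => (List.single_le_sum (by simp) x hx).trans (by omega)⟩
    · rintro ⟨h1, h2, h3, _⟩
      exact ⟨h1, h2, h3⟩
  rw [← this]
  rfl

theorem VV_zero (j : ℤ) (s : ℕ) : (VV 0 j s).ncard = if j = 0 ∧ s = 0 then 1 else 0 := by
  have : VV 0 j s = if j = 0 ∧ s = 0 then {[]} else ∅ := by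
    ext l
    rcases l with _ | ⟨a, l⟩
    · simp only [VV, Set.mem_ofPred_eq, bgRank_nil, IsPartition]
      split_ifs with h
      · simp [h.1, h.2]
      · simp; tauto
    · constructor
      · rintro ⟨⟨_, h2⟩, _, _, h5⟩
        have := h2 a (by simp)
        have := h5 a (by simp)
        omega
      · intro h
        split_ifs at h <;> simp at h
  rw [this]
  split_ifs <;> simp

open PowerSeries

/-- generating function -/
noncomputable def UU (N : ℕ) (j : ℤ) : (ZMod 5)⟦X⟧ :=
  PowerSeries.mk fun s => ((VV N j s).ncard : ZMod 5)

theorem UU_zero (j : ℤ) : UU 0 j = if j = 0 then 1 else 0 := by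
  ext s
  simp only [UU, coeff_mk, VV_zero]
  split_ifs with h h1 h1
  · simp [h.2]
  · tauto
  · simp [coeff_one]; tauto
  · simp

theorem UU_succ (N : ℕ) (j : ℤ) :
    UU (N + 1) j = UU N j + X ^ (N + 1) * UU (N + 1) (((N + 1 : ℕ) : ℤ) % 2 - j) := by
  ext s
  rw [map_add, coeff_X_pow_mul']
  simp only [UU, coeff_mk]
  rw [VV_succ]
  split_ifs <;> simp

theorem UU_succ' (N : ℕ) (j : ℤ) :
    (1 - X ^ (2 * (N + 1))) * UU (N + 1) j = UU N j + X ^ (N + 1) * UU N (((N + 1 : ℕ) : ℤ) % 2 - j) := by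
  have h1 := UU_succ N j
  have h2 := UU_succ N (((N + 1 : ℕ) : ℤ) % 2 - j)
  rw [sub_sub_cancel] at h2
  linear_combination h1 + X ^ (N + 1) * h2

/-- exponent -/
def ee (j : ℤ) : ℕ := (2 * j ^ 2 - j).toNat

theorem ee_spec (j : ℤ) : (ee j : ℤ) = 2 * j ^ 2 - j := by
  unfold ee
  apply Int.toNat_of_nonneg
  rcases le_or_gt j 0 with h | h <;> nlinarith

theorem one_sub_ne (k : ℕ) (hk : 0 < k) : (1 - X ^ k : (ZMod 5)⟦X⟧) ≠ 0 := by
  intro h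
  have := congrArg (constantCoeff (R := ZMod 5)) h
  simp [hk.ne'] at this
  revert this
  decide

local notation "Q" => qP (X ^ 2 : PowerSeries (ZMod 5))

theorem UU_formula (N : ℕ) :
    (∀ j : ℤ, (((N / 2 : ℕ) : ℤ) + j < 0 ∨ (N : ℤ) - (N / 2 : ℕ) - j < 0) → UU N j = 0) ∧
    (∀ (j : ℤ) (a b : ℕ), (a : ℤ) = ((N / 2 : ℕ) : ℤ) + j → (b : ℤ) = (N : ℤ) - (N / 2 : ℕ) - j →
      UU N j * Q a * Q b = X ^ ee j) := by
  have : Fact (Nat.Prime 5) := ⟨by norm_num⟩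
  induction N with
  | zero =>
    constructor
    · intro j hj
      rw [UU_zero, if_neg]
      simp at hj; omega
    · intro j a b ha hb
      simp at ha hb
      obtain rfl : j = 0 := by omega
      obtain rfl : a = 0 := by omega
      obtain rfl : b = 0 := by omega
      simp [UU_zero, qP_zero, ee]
  | succ N ih =>
    obtain ⟨ih0, ih1⟩ := ih
    have hne : (1 - X ^ (2 * (N + 1)) : (ZMod 5)⟦X⟧) ≠ 0 := one_sub_ne _ (by omega)
    constructor
    · intro j hj
      have h := UU_succ' N j
      rw [ih0 j (by omega), ih0 _ (by omega)] at h
      simp at h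
      tauto
    · intro j a b ha hb
      apply mul_left_cancel₀ hne
      have h := UU_succ' N j
      have hB : ∀ j' : ℤ, ∀ c : ℕ, (c : ℤ) + ((N / 2 : ℕ) : ℤ) + j' = N → 
        ∀ d : ℕ, (d : ℤ) = ((N / 2 : ℕ) : ℤ) + j' + 1 → UU N j' * Q d * Q c = X ^ ee j' * (1 - X ^ (2 * d)) := by
        intro j' c hc d hd
        rcases d with _ | d
        · rw [ih0 j' (by omega)]; simp
        · rw [qP_succ, ← ih1 j' d c (by omega) (by omega)]; ring
      have hA : ∀ j' : ℤ, ∀ c : ℕ, (c : ℤ) + ((N / 2 : ℕ) : ℤ) + j' = N + 1 → 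
        ∀ d : ℕ, (d : ℤ) = ((N / 2 : ℕ) : ℤ) + j' → UU N j' * Q d * Q c = X ^ ee j' * (1 - X ^ (2 * c)) := by
        intro j' c hc d hd
        rcases c with _ | c
        · rw [ih0 j' (by omega)]; simp
        · rw [qP_succ, ← ih1 j' d c (by omega) (by omega)]; ring
      have e1 := ee_spec j
      have e2 := ee_spec (((N + 1 : ℕ) : ℤ) % 2 - j)
      have hab : N + 1 = a + b := by omega
      rcases Nat.even_or_odd' N with ⟨M, hM | hM⟩
      · have hε : ((N + 1 : ℕ) : ℤ) % 2 = 1 := by omega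
        rw [hε] at h e2
        have g1 := hA j b (by omega) a (by omega)
        have g2 := hA (1 - j) a (by omega) b (by omega)
        have g3 : N + 1 + ee (1 - j) = ee j + 2 * b := by
          have : 2 * (b : ℤ) = N + 2 - 2 * j := by omega
          zify
          rw [e1, e2, this]; ring
        have g4 : (X : (ZMod 5)⟦X⟧) ^ (N + 1) * X ^ ee (1 - j) = X ^ ee j * X ^ (2 * b) := by
          rw [← pow_add, ← pow_add, g3]
        have g5 : (X : (ZMod 5)⟦X⟧) ^ (2 * (N + 1)) = X ^ (2 * a) * X ^ (2 * b) := by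
          rw [← pow_add, hab]; ring
        rw [g5] at h ⊢
        linear_combination Q a * Q b * h + g1 + X ^ (N + 1) * g2 + (1 - X ^ (2 * a)) * g4
      · have hε : ((N + 1 : ℕ) : ℤ) % 2 = 0 := by omega
        rw [hε] at h e2
        have g1 := hB j b (by omega) a (by omega)
        have g2 := hB (0 - j) a (by omega) b (by omega)
        have g3 : N + 1 + ee (0 - j) = ee j + 2 * a := by
          have : 2 * (a : ℤ) = N + 1 + 2 * j := by omega
          zify
          rw [e1, e2, this]; ring
        have g4 : (X : (ZMod 5)⟦X⟧) ^ (N + 1) * X ^ ee (0 - j) = X ^ ee j * X ^ (2 * a) := by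
          rw [← pow_add, ← pow_add, g3]
        have g5 : (X : (ZMod 5)⟦X⟧) ^ (2 * (N + 1)) = X ^ (2 * a) * X ^ (2 * b) := by
          rw [← pow_add, hab]; ring
        rw [g5] at h ⊢
        linear_combination Q a * Q b * h + g1 + X ^ (N + 1) * g2 + (1 - X ^ (2 * b)) * g4

end BG

section Final
open PowerSeries

theorem two_ne_zmod : (2 : ZMod 5) ≠ 0 := by decide

theorem five_eq_zero : (5 : (ZMod 5)⟦X⟧) = 0 := by
  have h : (5 : ZMod 5) = 0 := by decide
  have := congrArg (PowerSeries.C (R := ZMod 5)) h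
  rw [map_ofNat, map_zero] at this
  exact this

theorem one_sub_pow_five (Y : (ZMod 5)⟦X⟧) : (1 - Y) ^ 5 = 1 - Y ^ 5 := by
  linear_combination (-Y + 2 * Y ^ 2 - 2 * Y ^ 3 + Y ^ 4) * five_eq_zero

theorem strip_factor (n k : ℕ) (hk : 0 < k) (f : (ZMod 5)⟦X⟧)
    (h : ∀ i, i ≤ n → i % 5 = 2 → coeff i (f * (1 - X ^ (5 * k))) = 0) :
    ∀ i, i ≤ n → i % 5 = 2 → coeff i f = 0 := by
  intro i
  induction i using Nat.strong_induction_on with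
  | _ i ih =>
    intro hi hi5
    have h1 := h i hi hi5
    rw [mul_sub, mul_one, map_sub, coeff_mul_X_pow'] at h1
    split_ifs at h1 with hc
    · rw [ih (i - 5 * k) (by omega) (by omega) (by omega)] at h1
      simpa using h1
    · simpa using h1

theorem strip_all (n M : ℕ) : ∀ (f : (ZMod 5)⟦X⟧)
    (_ : ∀ i, i ≤ n → i % 5 = 2 → coeff i (f * qP (X ^ 2) M ^ 5) = 0),
    ∀ i, i ≤ n → i % 5 = 2 → coeff i f = 0 := by
  induction M with
  | zero => intro f h; simpa [qP_zero] using h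
  | succ M ih =>
    intro f h
    apply ih
    apply strip_factor n (2 * (M + 1)) (by omega)
    intro i hi hi5
    rw [← h i hi hi5, qP_succ, mul_pow, one_sub_pow_five]
    congr 1
    ring

theorem tt_large (d m : ℕ) (h : m < d ∨ 2 * (3 * d + 3) + 1 - m < d) (hm : m ≤ 2 * (3 * d + 3) + 1) :
    d ≤ tt (3 * d + 3) m := by
  have h1 := tt_spec (3 * d + 3) m
  rcases h with h | h
  · have h2 : (2 * d + 3 : ℤ) ≤ ((3 * d + 3 : ℕ) : ℤ) - m := by push_cast; omega
    have : (0 : ℤ) ≤ d := by positivity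
    zify
    nlinarith
  · have h2 : (((3 * d + 3 : ℕ) : ℤ) - m) + 1 ≤ - (2 * d + 2 : ℤ) := by push_cast; omega
    have : (0 : ℤ) ≤ d := by positivity
    zify
    nlinarith

theorem residues : ∀ j k : ZMod 5, (j = 1 ∨ j = 2 ∨ j = 4) →
    2 * j ^ 2 - j + k * (k + 1) = 2 → 2 * k + 1 = 0 := by decide

theorem coeff_rhs (j : ℤ) (hj : j % 5 = 1 ∨ j % 5 = 2 ∨ j % 5 = 4) (N m i : ℕ) (hi : i % 5 = 2) :
    coeff i (X ^ ee j * ((-1) ^ m * (2 * (N : (ZMod 5)⟦X⟧) + 1 - 2 * (m : (ZMod 5)⟦X⟧)) * (X ^ 2) ^ tt N m)) = 0 := by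
  have e : (X ^ ee j * ((-1) ^ m * (2 * (N : (ZMod 5)⟦X⟧) + 1 - 2 * (m : (ZMod 5)⟦X⟧)) * (X ^ 2) ^ tt N m))
      = C ((-1) ^ m * (2 * (N : ZMod 5) + 1 - 2 * m)) * X ^ (ee j + 2 * tt N m) := by
    simp only [map_mul, map_pow, map_neg, map_one, map_sub, map_add, map_natCast, map_ofNat]
    ring
  rw [e, coeff_C_mul, coeff_X_pow]
  split_ifs with h
  · have h1 : (i : ℤ) = 2 * j ^ 2 - j + ((N : ℤ) - m) * ((N : ℤ) - m + 1) := by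
      rw [← ee_spec, ← tt_spec, h]; push_cast; ring
    have h2 := congrArg (Int.cast (R := ZMod 5)) h1
    push_cast at h2
    have hi' : (i : ZMod 5) = 2 := by
      have : i = 5 * (i / 5) + 2 := by omega
      rw [this]; push_cast
      rw [show (5 : ZMod 5) = 0 by decide]; ring
    have hj' : (j : ZMod 5) = 1 ∨ (j : ZMod 5) = 2 ∨ (j : ZMod 5) = 4 := by
      have e5 : (j : ZMod 5) = ((j % 5 : ℤ) : ZMod 5) := by
        conv_lhs => rw [← Int.emod_add_mul_ediv j 5]
        push_cast
        rw [show (5 : ZMod 5) = 0 by decide]; ring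
      rcases hj with h | h | h <;> rw [e5, h] <;> simp
    have := residues j ((N : ZMod 5) - m) hj' (by rw [← h2, hi'])
    rw [show (2 * (N : ZMod 5) + 1 - 2 * m) = 2 * ((N : ZMod 5) - m) + 1 by ring, this]
    simp
  · simp

theorem qP_stable {B : Type*} [CommRing B] (x : B) (d : ℕ) (hx : x ^ d = 0) (k : ℕ) :
    qP x (d + k) = qP x d := by
  induction k with
  | zero => rfl
  | succ k ih =>
    rw [← add_assoc, qP_succ, ih, show d + k + 1 = d + (k + 1) by ring, pow_add, hx]
    simp

theorem map_qP {A B : Type*} [CommRing A] [CommRing B] (φ : A →+* B) (x : A) (n : ℕ) :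
    φ (qP x n) = qP (φ x) n := by
  simp [qP]

end Final

theorem pj_five_mul_add_two_cong (n : ℕ) (j : ℤ)
    (hj : j % 5 = 1 ∨ j % 5 = 2 ∨ j % 5 = 4) :
    (5 : ℕ) ∣ pj j (5 * n + 2) := by
  have : Fact (Nat.Prime 5) := ⟨by norm_num⟩
  obtain ⟨d, hd⟩ : ∃ d, d = 5 * n + 3 := ⟨_, rfl⟩
  obtain ⟨M, hM⟩ : ∃ M, M = d + j.natAbs := ⟨_, rfl⟩
  obtain ⟨a, ha⟩ : ∃ a : ℕ, (a : ℤ) = M + j := ⟨(M + j).toNat, by omega⟩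
  obtain ⟨b, hb⟩ : ∃ b : ℕ, (b : ℤ) = M - j := ⟨(M - j).toNat, by omega⟩
  have hU := (UU_formula (2 * M)).2 j a b (by omega) (by omega)
  rw [pj_eq_VV j (5 * n + 2) (2 * M) (by omega)]
  rw [← ZMod.natCast_eq_zero_iff]
  have hco : (((VV (2 * M) j (5 * n + 2)).ncard : ℕ) : ZMod 5) =
      PowerSeries.coeff (5 * n + 2) (UU (2 * M) j) := by simp [UU]
  rw [hco]
  generalize UU (2 * M) j = U at hU
  obtain ⟨N, hN⟩ : ∃ N, N = 3 * d + 3 := ⟨_, rfl⟩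
  have hJ := jacobi_fin (PowerSeries.X ^ 2 : PowerSeries (ZMod 5)) (pow_ne_zero _ PowerSeries.X_ne_zero) N
  let I : Ideal (PowerSeries (ZMod 5)) := Ideal.span {PowerSeries.X ^ d}
  let φ := Ideal.Quotient.mk I
  have hφ : ∀ f, φ f = 0 ↔ ∀ i, i < d → PowerSeries.coeff i f = 0 := by
    intro f
    rw [Ideal.Quotient.eq_zero_iff_mem, Ideal.mem_span_singleton, PowerSeries.X_pow_dvd_iff]
  have hx : φ (PowerSeries.X ^ 2) ^ d = 0 := by
    rw [← map_pow, Ideal.Quotient.eq_zero_iff_mem, Ideal.mem_span_singleton]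
    exact ⟨PowerSeries.X ^ d, by ring⟩
  obtain ⟨p, hp⟩ : ∃ p, p = φ (qP (PowerSeries.X ^ 2) d) := ⟨_, rfl⟩
  have hst : ∀ k, d ≤ k → φ (qP (PowerSeries.X ^ 2) k) = p := by
    intro k hk
    obtain ⟨k, rfl⟩ := Nat.exists_eq_add_of_le hk
    rw [hp, map_qP, map_qP, qP_stable _ _ hx]
  have hU' := congrArg φ hU
  simp only [map_mul] at hU'
  rw [hst a (by omega), hst b (by omega)] at hU'
  have hpunit : IsUnit p := by
    rw [hp]
    apply IsUnit.map
    rw [PowerSeries.isUnit_iff_constantCoeff]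
    simp [qP]
  have hJ' := congrArg φ hJ
  rw [map_mul, map_pow φ (qP _ N), hst N (by omega), map_sum] at hJ'
  have hterm : ∀ m ∈ Finset.range (2 * N + 2),
      φ ((-1) ^ m * (2 * (N : PowerSeries (ZMod 5)) + 1 - 2 * (m : PowerSeries (ZMod 5))) * (PowerSeries.X ^ 2) ^ tt N m * qG (PowerSeries.X ^ 2) (2 * N + 1) m) * p
      = φ ((-1) ^ m * (2 * (N : PowerSeries (ZMod 5)) + 1 - 2 * (m : PowerSeries (ZMod 5))) * (PowerSeries.X ^ 2) ^ tt N m) := by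
    intro m hm
    have hm' := Finset.mem_range.mp hm
    by_cases hc : m < d ∨ 2 * N + 1 - m < d
    · have ht : d ≤ tt N m := by
        subst hN
        exact tt_large d m hc (by omega)
      have : φ ((PowerSeries.X ^ 2) ^ tt N m) = 0 := by
        rw [map_pow]
        exact pow_eq_zero_of_le ht hx
      simp only [map_mul]
      rw [this]; simp
    · push Not at hc
      have hg := congrArg φ (qG_mul (PowerSeries.X ^ 2 : PowerSeries (ZMod 5)) (2 * N + 1) m (2 * N + 1 - m) (by omega))
      rw [show m + (2 * N + 1 - m) = 2 * N + 1 by omega] at hg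
      simp only [map_mul] at hg
      rw [hst m hc.1, hst _ hc.2, hst _ (by omega)] at hg
      have hg' : φ (qG (PowerSeries.X ^ 2) (2 * N + 1) m) * p = 1 := by
        apply hpunit.mul_right_cancel
        rw [hg, one_mul]
      rw [map_mul, mul_assoc, hg', mul_one]
  have hmain : φ (2 * (-1) ^ N * U * qP (PowerSeries.X ^ 2) N ^ 5) =
      φ (∑ m ∈ Finset.range (2 * N + 2), PowerSeries.X ^ ee j * ((-1) ^ m * (2 * (N : PowerSeries (ZMod 5)) + 1 - 2 * (m : PowerSeries (ZMod 5))) * (PowerSeries.X ^ 2) ^ tt N m)) := by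
    rw [← Finset.mul_sum, map_mul φ (PowerSeries.X ^ ee j), map_sum, ← Finset.sum_congr rfl hterm, ← Finset.sum_mul, ← hJ', ← hU']
    rw [map_mul, map_mul, map_pow φ (qP _ N), hst N (by omega)]
    ring
  have hz := (hφ _).1 (sub_eq_zero.mpr hmain ▸ map_sub φ _ _)
  have hs := strip_all (5 * n + 2) N (2 * (-1) ^ N * U) (by
    intro i hi hi5
    have h1 := hz i (by omega)
    rw [map_sub, sub_eq_zero] at h1
    rw [h1, map_sum]
    exact Finset.sum_eq_zero fun m _ => coeff_rhs j hj N m i hi5) (5 * n + 2) le_rfl (by omega)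
  have hC : (2 * (-1) ^ N * U : PowerSeries (ZMod 5)) = PowerSeries.C (2 * (-1) ^ N) * U := by
    rw [map_mul, map_pow, map_neg, map_one, map_ofNat]
  rw [hC, PowerSeries.coeff_C_mul] at hs
  rcases mul_eq_zero.mp hs with h | h
  · exfalso
    rcases mul_eq_zero.mp h with h | h
    · exact two_ne_zmod h
    · exact pow_ne_zero N (neg_ne_zero.mpr one_ne_zero) h
  · exact h
end
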